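/- Let K ⊆ ℝ be a real quadratic number field, (A_n)_n a sequence with values in K, and (B_n)_n a sequence of rational numbers with bounded denominators. Then the sequence (ℓ(A_n))_n of period lengths is bounded if and only if the sequence (ℓ(A_n + B_n))_n is bounded. -/

import Mathlib

open Polynomial Filter

/-- The Gauss map used to generate the continued fraction expansion of a real number. -/
noncomputable def cfMap (x : ℝ) : ℝ := if Int.fract x = 0 then 0 else (Int.fract x)⁻¹

/-- The `i`-th partial quotient `a_i(x)` of the continued fraction expansion of `x`. -/
noncomputable def cfa (x : ℝ) (i : ℕ) : ℤ := ⌊cfMap^[i] x⌋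

/-- The minimal eventual period length `ℓ(x)` of the continued fraction expansion of `x`,
with the convention `ℓ(x) = 0` for rational `x`. -/
noncomputable def periodLength (x : ℝ) : ℕ :=
  open scoped Classical in
  if Irrational x then sInf {p : ℕ | 0 < p ∧ ∃ N : ℕ, ∀ n ≥ N, cfa x (n + p) = cfa x n} else 0

/-- Numerators of the convergents with partial quotients `a`, shifted so that index `0` is the
formal convergent `1 / 0`. -/
def cfNum (a : ℕ → ℤ) : ℕ → ℤ
  | 0 => 1
  | 1 => a 0
  | n + 2 => a (n + 1) * cfNum a (n + 1) + cfNum a n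

/-- Denominators of the convergents with partial quotients `a`, shifted like `cfNum`. -/
def cfDen (a : ℕ → ℤ) : ℕ → ℤ
  | 0 => 0
  | 1 => 1
  | n + 2 => a (n + 1) * cfDen a (n + 1) + cfDen a n

/-- The continued fraction expansion of `x` is eventually periodic with period `p`. -/
def CfPeriodic (x : ℝ) (p : ℕ) : Prop := ∃ N : ℕ, ∀ n ≥ N, cfa x (n + p) = cfa x n

theorem Irrational.fract_pos {x : ℝ} (hx : Irrational x) : 0 < Int.fract x :=
  lt_of_le_of_ne (Int.fract_nonneg x) fun h => hx ⟨⌊x⌋, by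
    have := Int.floor_add_fract x
    rw [← h] at this
    simpa using this⟩

theorem cfMap_of_irrational {x : ℝ} (hx : Irrational x) : cfMap x = (Int.fract x)⁻¹ :=
  if_neg hx.fract_pos.ne'

theorem irrational_cfMap {x : ℝ} (hx : Irrational x) : Irrational (cfMap x) := by
  rw [cfMap_of_irrational hx, irrational_inv_iff]
  exact hx.sub_intCast _

theorem one_lt_cfMap {x : ℝ} (hx : Irrational x) : 1 < cfMap x := by
  rw [cfMap_of_irrational hx]
  exact (one_lt_inv₀ hx.fract_pos).2 (Int.fract_lt_one x)

theorem irrational_iterate_cfMap {x : ℝ} (hx : Irrational x) (n : ℕ) :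
    Irrational (cfMap^[n] x) := by
  induction n with
  | zero => exact hx
  | succ n ih => rw [Function.iterate_succ_apply']; exact irrational_cfMap ih

theorem one_lt_iterate_cfMap {x : ℝ} (hx : Irrational x) (n : ℕ) : 1 < cfMap^[n + 1] x := by
  rw [Function.iterate_succ_apply']
  exact one_lt_cfMap (irrational_iterate_cfMap hx n)

theorem iterate_cfMap_sub_cfa_mul {x : ℝ} (hx : Irrational x) (n : ℕ) :
    (cfMap^[n] x - cfa x n) * cfMap^[n + 1] x = 1 := by
  rw [Function.iterate_succ_apply', cfMap_of_irrational (irrational_iterate_cfMap hx n)]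
  exact mul_inv_cancel₀ (irrational_iterate_cfMap hx n).fract_pos.ne'

theorem one_le_cfa_succ {x : ℝ} (hx : Irrational x) (n : ℕ) : 1 ≤ cfa x (n + 1) :=
  Int.le_floor.2 (by simpa using (one_lt_iterate_cfMap hx n).le)

theorem cfa_iterate (x : ℝ) (i k : ℕ) : cfa (cfMap^[i] x) k = cfa x (i + k) := by
  simp only [cfa, ← Function.iterate_add_apply, add_comm]

theorem cfNum_mul_cfDen_sub (a : ℕ → ℤ) (n : ℕ) :
    cfNum a (n + 1) * cfDen a n - cfNum a n * cfDen a (n + 1) = (-1) ^ (n + 1) := by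
  induction n with
  | zero => simp [cfNum, cfDen]
  | succ n ih =>
    rw [pow_succ, ← ih]
    simp only [cfNum, cfDen]
    ring

section Denominators

variable {a : ℕ → ℤ}

theorem cfDen_nonneg_and_succ_pos (ha : ∀ n, 1 ≤ a (n + 1)) (n : ℕ) :
    0 ≤ cfDen a n ∧ 1 ≤ cfDen a (n + 1) := by
  induction n with
  | zero => simp [cfDen]
  | succ n ih =>
    refine ⟨by linarith [ih.2], ?_⟩
    simp only [cfDen]
    nlinarith [ha n, ih.1, ih.2]

theorem monotone_cfDen (ha : ∀ n, 1 ≤ a (n + 1)) : Monotone (cfDen a) := by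
  refine monotone_nat_of_le_succ fun n => ?_
  cases n with
  | zero => simp [cfDen]
  | succ n =>
    have h := cfDen_nonneg_and_succ_pos ha n
    simp only [cfDen]
    nlinarith [ha n, h.1, h.2]

theorem le_cfDen_add_one (ha : ∀ n, 1 ≤ a (n + 1)) (n : ℕ) : (n : ℤ) ≤ cfDen a n + 1 := by
  induction n using Nat.strong_induction_on with
  | _ n ih =>
    match n with
    | 0 => simp [cfDen]
    | 1 => simp [cfDen]
    | 2 => simp only [cfDen]; push_cast; linarith [ha 0]
    | n + 3 =>
      have h := ih (n + 2) (by omega)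
      have h1 := cfDen_nonneg_and_succ_pos ha n
      have h2 := cfDen_nonneg_and_succ_pos ha (n + 1)
      rw [cfDen]
      push_cast at h ⊢
      nlinarith [ha (n + 1), h1.2, h2.2]

end Denominators

/-- The linear form `q x - p` at the (shifted) `n`-th convergent `p / q` of `x`. -/
noncomputable def cfErr (x : ℝ) (n : ℕ) : ℝ := cfDen (cfa x) n * x - cfNum (cfa x) n

theorem cfErr_succ_mul {x : ℝ} (hx : Irrational x) (n : ℕ) :
    cfErr x (n + 1) * cfMap^[n + 1] x = -cfErr x n := by
  induction n with
  | zero =>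
    have h := iterate_cfMap_sub_cfa_mul hx 0
    simp only [Function.iterate_zero, id] at h
    simp only [cfErr, cfNum, cfDen]
    push_cast
    linarith
  | succ n ih =>
    have h := iterate_cfMap_sub_cfa_mul hx (n + 1)
    have h1 : cfErr x (n + 2) = cfa x (n + 1) * cfErr x (n + 1) + cfErr x n := by
      simp only [cfErr, cfNum, cfDen]
      push_cast
      ring
    have h2 : cfErr x (n + 2) = -cfErr x (n + 1) * (cfMap^[n + 1] x - cfa x (n + 1)) := by
      rw [h1, ← neg_neg (cfErr x n), ← ih]
      ring
    rw [h2, mul_assoc, h, mul_one]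

theorem cfErr_mul_cfDen_sub (x : ℝ) (n : ℕ) :
    cfErr x n * cfDen (cfa x) (n + 1) - cfErr x (n + 1) * cfDen (cfa x) n = (-1) ^ (n + 1) := by
  have h := cfNum_mul_cfDen_sub (cfa x) n
  have h' := congrArg (Int.cast : ℤ → ℝ) h
  push_cast at h'
  rw [← h']
  simp only [cfErr]
  ring

theorem one_le_cfDen_succ {x : ℝ} (hx : Irrational x) (n : ℕ) :
    (1 : ℝ) ≤ cfDen (cfa x) (n + 1) := by
  exact_mod_cast (cfDen_nonneg_and_succ_pos (one_le_cfa_succ hx) n).2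

theorem cfDen_nonneg {x : ℝ} (hx : Irrational x) (n : ℕ) : (0 : ℝ) ≤ cfDen (cfa x) n := by
  exact_mod_cast (cfDen_nonneg_and_succ_pos (one_le_cfa_succ hx) n).1

theorem abs_cfErr_le {x : ℝ} (hx : Irrational x) (n : ℕ) :
    |cfErr x n| ≤ 1 / cfDen (cfa x) (n + 1) := by
  have hv := one_le_cfDen_succ hx n
  have hv0 := cfDen_nonneg hx n
  have hX := one_lt_iterate_cfMap hx n
  have h1 := cfErr_succ_mul hx n
  have h2 := cfErr_mul_cfDen_sub x n
  set X := cfMap^[n + 1] x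
  set e := cfErr x (n + 1)
  set v := (cfDen (cfa x) (n + 1) : ℝ)
  set v0 := (cfDen (cfa x) n : ℝ)
  have he : cfErr x n = -(e * X) := by linarith
  rw [he] at h2 ⊢
  have h3 : |e| * (X * v + v0) = 1 := by
    have : |-(e * X) * v - e * v0| = 1 := by rw [h2]; simp
    rw [show -(e * X) * v - e * v0 = -(e * (X * v + v0)) by ring, abs_neg, abs_mul,
      abs_of_nonneg (by positivity : 0 ≤ X * v + v0)] at this
    exact this
  rw [le_div_iff₀ (by linarith), abs_neg, abs_mul, abs_of_pos (by linarith : 0 < X)]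
  nlinarith [mul_nonneg (abs_nonneg e) hv0]

/-- An irrational number is determined by its partial quotients. -/
theorem eq_of_cfa_eq {s t : ℝ} (hs : Irrational s) (ht : Irrational t) (h : cfa s = cfa t) :
    s = t := by
  by_contra hne
  have hpos : 0 < |s - t| := abs_pos.2 (sub_ne_zero.2 hne)
  obtain ⟨k, hk⟩ := exists_nat_gt (2 / |s - t|)
  rw [div_lt_iff₀ hpos] at hk
  have h1 := abs_cfErr_le hs (k + 1)
  have h2 := abs_cfErr_le ht (k + 1)
  have hle : (1 : ℝ) / cfDen (cfa s) (k + 2) ≤ 1 := by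
    rw [div_le_one (by linarith [one_le_cfDen_succ hs (k + 1)])]
    exact one_le_cfDen_succ hs (k + 1)
  have hv : (k : ℝ) ≤ cfDen (cfa s) (k + 1) := by
    have := le_cfDen_add_one (one_le_cfa_succ hs) (k + 1)
    push_cast at this
    exact_mod_cast (by linarith : (k : ℤ) ≤ cfDen (cfa s) (k + 1))
  have hdiff : cfErr s (k + 1) - cfErr t (k + 1) = cfDen (cfa s) (k + 1) * (s - t) := by
    simp only [cfErr, h]
    ring
  have h3 := abs_sub (cfErr s (k + 1)) (cfErr t (k + 1))
  rw [hdiff, abs_mul, abs_of_nonneg (cfDen_nonneg hs _)] at h3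
  rw [← h] at h2
  nlinarith

theorem CfPeriodic.iterate_eq {x : ℝ} (hx : Irrational x) {p N : ℕ}
    (hN : ∀ n ≥ N, cfa x (n + p) = cfa x n) {n : ℕ} (hn : N ≤ n) :
    cfMap^[n] x = cfMap^[N + (n - N) % p] x := by
  have step : ∀ i ≥ N, cfMap^[i + p] x = cfMap^[i] x := fun i hi =>
    eq_of_cfa_eq (irrational_iterate_cfMap hx _) (irrational_iterate_cfMap hx _) (funext fun k => by
      rw [cfa_iterate, cfa_iterate, ← hN (i + k) (by omega)]
      congr 1
      omega)
  have multi : ∀ k r, cfMap^[N + r + p * k] x = cfMap^[N + r] x := fun k r => by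
    induction k with
    | zero => rfl
    | succ k ih => rw [← ih, Nat.mul_succ, ← add_assoc]; exact step _ (by omega)
  have h := multi ((n - N) / p) ((n - N) % p)
  rwa [add_assoc, Nat.mod_add_div, Nat.add_sub_cancel' hn] at h

theorem cfPeriodic_of_fract_eq {y : ℝ} {i j : ℕ} (hij : i < j)
    (hy : Irrational y)
    (h : Int.fract (cfMap^[i] y) = Int.fract (cfMap^[j] y)) : CfPeriodic y (j - i) := by
  have h1 : cfMap^[i + 1] y = cfMap^[j + 1] y := by
    rw [Function.iterate_succ_apply', Function.iterate_succ_apply',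
      cfMap_of_irrational (irrational_iterate_cfMap hy i),
      cfMap_of_irrational (irrational_iterate_cfMap hy j), h]
  refine ⟨i + 1, fun n hn => ?_⟩
  obtain ⟨k, rfl⟩ := Nat.exists_eq_add_of_le hn
  rw [show i + 1 + k + (j - i) = j + 1 + k by omega, ← cfa_iterate, ← cfa_iterate, h1]

/-- The entries of the integer matrix relating the complete quotients of `x` and
of `y = x + m / D`. -/
noncomputable def cfCross (D m : ℤ) (x y : ℝ) (j n : ℕ) : ℤ :=
  D * cfDen (cfa y) j * cfNum (cfa x) n
    - (D * cfNum (cfa y) j - m * cfDen (cfa y) j) * cfDen (cfa x) n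

theorem cfCross_det (D m : ℤ) (x y : ℝ) (j n : ℕ) :
    |cfCross D m x y j (n + 1) * cfCross D m x y (j + 1) n
      - cfCross D m x y j n * cfCross D m x y (j + 1) (n + 1)| = D ^ 2 := by
  have h1 := cfNum_mul_cfDen_sub (cfa x) n
  have h2 := cfNum_mul_cfDen_sub (cfa y) j
  have : cfCross D m x y j (n + 1) * cfCross D m x y (j + 1) n
      - cfCross D m x y j n * cfCross D m x y (j + 1) (n + 1)
      = -(D ^ 2 * ((-1) ^ (n + 1) * (-1) ^ (j + 1))) := by
    rw [← h1, ← h2]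
    simp only [cfCross]
    ring
  rw [this, abs_neg, abs_mul, abs_mul]
  simp

section Translate

variable {D m : ℤ} {x y : ℝ}

theorem cfCross_eq (hxy : D * y = D * x + m) (j n : ℕ) :
    (cfCross D m x y j n : ℝ)
      = D * (cfDen (cfa x) n * cfErr y j - cfDen (cfa y) j * cfErr x n) := by
  have : (D : ℝ) * (cfDen (cfa x) n * cfErr y j - cfDen (cfa y) j * cfErr x n)
    = cfDen (cfa x) n * cfDen (cfa y) j * (D * y - D * x)
      + D * (cfDen (cfa y) j * cfNum (cfa x) n - cfDen (cfa x) n * cfNum (cfa y) j) := by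
    simp only [cfErr]
    ring
  rw [this, hxy]
  simp only [cfCross]
  push_cast
  ring

theorem abs_cfCross_le (hx : Irrational x) (hy : Irrational y) (hD : 0 < D)
    (hxy : D * y = D * x + m) (j n : ℕ) :
    |(cfCross D m x y j n : ℝ)| ≤ D * (cfDen (cfa x) n / cfDen (cfa y) (j + 1)
      + cfDen (cfa y) j / cfDen (cfa x) (n + 1)) := by
  have hD' : (0 : ℝ) < D := by exact_mod_cast hD
  rw [cfCross_eq hxy, abs_mul, abs_of_pos hD']
  gcongr
  refine (abs_sub _ _).trans ?_
  rw [abs_mul, abs_mul, abs_of_nonneg (cfDen_nonneg hx _), abs_of_nonneg (cfDen_nonneg hy _),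
    div_eq_mul_one_div, div_eq_mul_one_div (cfDen (cfa y) j : ℝ)]
  have h1 := abs_cfErr_le hy j
  have h2 := abs_cfErr_le hx n
  have h3 := cfDen_nonneg hx n
  have h4 := cfDen_nonneg hy j
  gcongr

/-- The complete quotients of `y` are images of those of `x` under the matrices `cfCross`. -/
theorem iterate_cfMap_mul_cfCross (hx : Irrational x) (hy : Irrational y)
    (hxy : D * y = D * x + m) (j n : ℕ) :
    cfMap^[j + 1] y * (cfCross D m x y (j + 1) (n + 1) * cfMap^[n + 1] x
      + cfCross D m x y (j + 1) n)
      = -(cfCross D m x y j (n + 1) * cfMap^[n + 1] x + cfCross D m x y j n) := by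
  have h1 := cfErr_succ_mul hx n
  have h2 := cfErr_succ_mul hy j
  simp only [cfCross_eq hxy]
  linear_combination (D * (cfDen (cfa x) (n + 1) * cfMap^[n + 1] x + cfDen (cfa x) n) : ℝ) * h2
    - (D * (cfDen (cfa y) (j + 1) * cfMap^[j + 1] y + cfDen (cfa y) j) : ℝ) * h1

theorem cfCross_bound_of_comparable (hx : Irrational x) (hy : Irrational y) (hD : 0 < D)
    (hxy : D * y = D * x + m) {j n : ℕ}
    (h1 : cfDen (cfa x) (n + 1) ≤ 2 * D * cfDen (cfa y) (j + 2))
    (h2 : cfDen (cfa y) (j + 1) ≤ 2 * D * cfDen (cfa x) (n + 1)) :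
    |cfCross D m x y (j + 1) (n + 1)| ≤ 4 * D ^ 2 ∧ |cfCross D m x y (j + 1) n| ≤ 4 * D ^ 2 := by
  have hD' : (0 : ℝ) < D := by exact_mod_cast hD
  have hmx := monotone_cfDen (one_le_cfa_succ hx)
  have e1 : (cfDen (cfa x) n : ℝ) ≤ cfDen (cfa x) (n + 1) := by exact_mod_cast hmx (by omega)
  have e2 : (cfDen (cfa x) (n + 1) : ℝ) ≤ cfDen (cfa x) (n + 2) := by
    exact_mod_cast hmx (by omega)
  have h1' : (cfDen (cfa x) (n + 1) : ℝ) ≤ 2 * D * cfDen (cfa y) (j + 2) := by exact_mod_cast h1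
  have h2' : (cfDen (cfa y) (j + 1) : ℝ) ≤ 2 * D * cfDen (cfa x) (n + 1) := by exact_mod_cast h2
  have p1 := one_le_cfDen_succ hx n
  have p2 := one_le_cfDen_succ hx (n + 1)
  have p3 := one_le_cfDen_succ hy (j + 1)
  have bound : ∀ k, (cfDen (cfa x) k : ℝ) ≤ cfDen (cfa x) (n + 1) →
      (cfDen (cfa x) (n + 1) : ℝ) ≤ cfDen (cfa x) (k + 1) →
      |cfCross D m x y (j + 1) k| ≤ 4 * D ^ 2 := fun k hk hk' => by
    have h := abs_cfCross_le hx hy hD hxy (j + 1) k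
    have q1 : (cfDen (cfa x) k : ℝ) / cfDen (cfa y) (j + 1 + 1) ≤ 2 * D := by
      rw [div_le_iff₀ (by linarith)]
      linarith
    have q2 : (cfDen (cfa y) (j + 1) : ℝ) / cfDen (cfa x) (k + 1) ≤ 2 * D := by
      rw [div_le_iff₀ (by linarith)]
      nlinarith
    have : |(cfCross D m x y (j + 1) k : ℝ)| ≤ 4 * D ^ 2 := by nlinarith
    exact_mod_cast this
  exact ⟨bound _ le_rfl e2, bound _ e1 le_rfl⟩

/-- For every `j` some `n` makes the second row of the matrix `cfCross` bounded. -/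
theorem exists_cfCross_bound (hx : Irrational x) (hy : Irrational y) (hD : 0 < D)
    (hxy : D * y = D * x + m) (j : ℕ) :
    ∃ n, |cfCross D m x y (j + 1) (n + 1)| ≤ 4 * D ^ 2 ∧
      |cfCross D m x y (j + 1) n| ≤ 4 * D ^ 2 ∧
      cfDen (cfa y) (j + 1) ≤ 2 * D * cfDen (cfa x) (n + 1) := by
  have hmx := monotone_cfDen (one_le_cfa_succ hx)
  have hmy := monotone_cfDen (one_le_cfa_succ hy)
  have hvy : 1 ≤ cfDen (cfa y) (j + 1) := by exact_mod_cast one_le_cfDen_succ hy j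
  have hvy2 : cfDen (cfa y) (j + 1) ≤ cfDen (cfa y) (j + 2) := hmy (by omega)
  obtain ⟨k, hk, hk'⟩ : ∃ k, cfDen (cfa x) (k + 1) ≤ D * cfDen (cfa y) (j + 1) ∧
      D * cfDen (cfa y) (j + 1) < cfDen (cfa x) (k + 2) := by
    have hex : ∃ k, D * cfDen (cfa y) (j + 1) < cfDen (cfa x) (k + 1) :=
      ⟨(D * cfDen (cfa y) (j + 1)).toNat + 1, by
        have := le_cfDen_add_one (one_le_cfa_succ hx) ((D * cfDen (cfa y) (j + 1)).toNat + 1 + 1)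
        push_cast at this
        have h' := Int.self_le_toNat (D * cfDen (cfa y) (j + 1))
        omega⟩
    classical
    have hspec := Nat.find_spec hex
    have hne : Nat.find hex ≠ 0 := fun h0 => by
      rw [h0] at hspec
      simp only [cfDen] at hspec
      nlinarith
    obtain ⟨k, hk⟩ := Nat.exists_eq_succ_of_ne_zero hne
    rw [hk] at hspec
    exact ⟨k, not_lt.1 (Nat.find_min hex (by omega)), hspec⟩
  have hup : cfDen (cfa y) (j + 1) ≤ 2 * D * cfDen (cfa x) (k + 2) := by
    have e1 : cfDen (cfa y) (j + 1) ≤ D * cfDen (cfa y) (j + 1) := by nlinarith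
    nlinarith
  by_cases hw : cfCross D m x y (j + 1) (k + 1) = 0
  · refine ⟨k + 1, ?_, ?_, ?_⟩
    · have hdet := cfCross_det D m x y j (k + 1)
      rw [hw, mul_zero, zero_sub, abs_neg, abs_mul] at hdet
      have h0 : cfCross D m x y j (k + 1) ≠ 0 := fun h => by
        rw [h, abs_zero, zero_mul] at hdet
        exact (pow_pos hD 2).ne hdet
      have := Int.one_le_abs h0
      nlinarith [abs_nonneg (cfCross D m x y (j + 1) (k + 1 + 1))]
    · rw [hw, abs_zero]
      positivity
    · exact hup
  · have hD' : (0 : ℝ) < D := by exact_mod_cast hD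
    have h1 : (1 : ℝ) ≤ |(cfCross D m x y (j + 1) (k + 1) : ℝ)| := by
      exact_mod_cast Int.one_le_abs hw
    have h2 := h1.trans (abs_cfCross_le hx hy hD hxy (j + 1) (k + 1))
    have p1 := one_le_cfDen_succ hx (k + 1)
    have p2 := one_le_cfDen_succ hy (j + 1)
    have hcases : cfDen (cfa y) (j + 2) ≤ 2 * D * cfDen (cfa x) (k + 1) ∨
        cfDen (cfa x) (k + 2) ≤ 2 * D * cfDen (cfa y) (j + 1) := by
      by_contra! hcon
      have c1 : (2 * D * cfDen (cfa x) (k + 1) : ℝ) < cfDen (cfa y) (j + 1 + 1) := by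
        exact_mod_cast hcon.1
      have c2 : (2 * D * cfDen (cfa y) (j + 1) : ℝ) < cfDen (cfa x) (k + 1 + 1) := by
        exact_mod_cast hcon.2
      have d1 : (2 * D : ℝ) * (cfDen (cfa x) (k + 1) / cfDen (cfa y) (j + 1 + 1)) < 1 := by
        rw [← mul_div_assoc, div_lt_one (by linarith)]
        exact c1
      have d2 : (2 * D : ℝ) * (cfDen (cfa y) (j + 1) / cfDen (cfa x) (k + 1 + 1)) < 1 := by
        rw [← mul_div_assoc, div_lt_one (by linarith)]
        exact c2
      linarith
    rcases hcases with h | h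
    · have c2 : cfDen (cfa y) (j + 1) ≤ 2 * D * cfDen (cfa x) (k + 1) := hvy2.trans h
      have := cfCross_bound_of_comparable hx hy hD hxy (j := j) (n := k) (by nlinarith) c2
      exact ⟨k, this.1, this.2, c2⟩
    · have := cfCross_bound_of_comparable hx hy hD hxy (j := j) (n := k + 1) (by nlinarith) hup
      exact ⟨k + 1, this.1, this.2, hup⟩

end Translate

/-- Integer matrices of equal determinant with the same second row, and with first rows
congruent modulo a multiple of its entries, act on `X` by numbers with equal fractional part. -/
theorem fract_eq_of_rows {a b a' b' c d L : ℤ} {X Y Y' : ℝ}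
    (hcd : c * X + d ≠ 0) (hdet : a * d - b * c = a' * d - b' * c)
    (hc : c ≠ 0 → c ∣ L) (hd : d ≠ 0 → d ∣ L) (ha : L ∣ a - a') (hb : L ∣ b - b')
    (hY : Y * (c * X + d) = -(a * X + b)) (hY' : Y' * (c * X + d) = -(a' * X + b')) :
    Int.fract Y = Int.fract Y' := by
  obtain ⟨t, hta, htb⟩ : ∃ t : ℤ, a - a' = t * c ∧ b - b' = t * d := by
    by_cases hc0 : c = 0
    · by_cases hd0 : d = 0
      · simp [hc0, hd0] at hcd
      · obtain ⟨t, ht⟩ := (hd hd0).trans hb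
        refine ⟨t, ?_, by rw [ht]; ring⟩
        apply mul_right_cancel₀ hd0
        linear_combination hdet + c * ht
    · obtain ⟨t, ht⟩ := (hc hc0).trans ha
      refine ⟨t, by rw [ht]; ring, ?_⟩
      apply mul_right_cancel₀ hc0
      linear_combination -hdet + d * ht
  have hta' : (a : ℝ) - a' = t * c := by exact_mod_cast hta
  have htb' : (b : ℝ) - b' = t * d := by exact_mod_cast htb
  have : Y = Y' - t := by
    apply mul_right_cancel₀ hcd
    linear_combination hY - hY' - X * hta' - htb'
  rw [this, Int.fract_sub_intCast]

/-- Translation by a rational number of denominator `D` multiplies period lengths by at most a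
constant depending on `D`. -/
theorem exists_cfPeriodic_translate (D : ℕ) (hD : 0 < D) :
    ∃ K : ℕ, ∀ (x y : ℝ) (m : ℤ) (p : ℕ), Irrational x → Irrational y → D * y = D * x + m →
      0 < p → CfPeriodic x p → ∃ q, 0 < q ∧ q ≤ K * p ∧ CfPeriodic y q := by
  let L : ℕ := (4 * D ^ 2).factorial
  have : NeZero L := ⟨Nat.factorial_ne_zero _⟩
  let S := Set.Icc (-(4 * (D : ℤ) ^ 2)) (4 * (D : ℤ) ^ 2)
  let T := (S × S × S) × (ZMod L × ZMod L)
  refine ⟨Fintype.card T, fun x y m p hx hy hxy hp ⟨N, hN⟩ => ?_⟩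
  have hDZ : (0 : ℤ) < D := by exact_mod_cast hD
  have hxy' : ((D : ℤ) : ℝ) * y = ((D : ℤ) : ℝ) * x + m := by exact_mod_cast hxy
  choose n hn1 hn2 hn3 using exists_cfCross_bound hx hy hDZ hxy'
  let w := cfCross D m x y
  let J : ℕ := (2 * D * cfDen (cfa x) N).toNat + 1
  have hdet : ∀ j, w j (n j + 1) * w (j + 1) (n j) - w j (n j) * w (j + 1) (n j + 1) ∈ S :=
    fun j => abs_le.1 ((cfCross_det D m x y j (n j)).le.trans (by nlinarith))
  let f : Fin (Fintype.card T * p + 1) → T × Fin p := fun i =>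
    let j := J + i
    (((⟨w (j + 1) (n j + 1), abs_le.1 (hn1 j)⟩, ⟨w (j + 1) (n j), abs_le.1 (hn2 j)⟩,
      ⟨_, hdet j⟩), ((w j (n j + 1) : ZMod L), (w j (n j) : ZMod L))),
      ⟨(n j + 1 - N) % p, Nat.mod_lt _ hp⟩)
  obtain ⟨i, i', hne, hf⟩ := Fintype.exists_ne_map_eq_of_card_lt f (by simp)
  wlog hlt : i < i' generalizing i i'
  · exact this i' i hne.symm hf.symm (lt_of_le_of_ne (not_lt.1 hlt) hne.symm)
  have hlt' : (i : ℕ) < i' := hlt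
  have hi' := i'.isLt
  refine ⟨J + i' + 1 - (J + i + 1), by omega, by omega, cfPeriodic_of_fract_eq (by omega)
    hy ?_⟩
  have hnN : ∀ j ≥ J, N ≤ n j + 1 := fun j hj => by
    by_contra! hcon
    have h1 := monotone_cfDen (one_le_cfa_succ hx) hcon.le
    have h2 := le_cfDen_add_one (one_le_cfa_succ hy) (j + 1)
    have h3 := hn3 j
    have h4 := Int.self_le_toNat (2 * D * cfDen (cfa x) N)
    have h5 : 2 * (D : ℤ) * cfDen (cfa x) (n j + 1) ≤ 2 * D * cfDen (cfa x) N := by gcongr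
    push_cast at h2
    omega
  have hc := congrArg (fun t : T × Fin p => (t.1.1.1 : ℤ)) hf
  have hd := congrArg (fun t : T × Fin p => (t.1.1.2.1 : ℤ)) hf
  have hdt := congrArg (fun t : T × Fin p => (t.1.1.2.2 : ℤ)) hf
  have ha := congrArg (fun t : T × Fin p => t.1.2.1) hf
  have hb := congrArg (fun t : T × Fin p => t.1.2.2) hf
  have hmod := congrArg (fun t : T × Fin p => (t.2 : ℕ)) hf
  simp only [f] at hc hd hdt ha hb hmod
  have hX : cfMap^[n (J + i) + 1] x = cfMap^[n (J + i') + 1] x := by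
    rw [CfPeriodic.iterate_eq hx hN (hnN _ (by omega)), hmod,
      ← CfPeriodic.iterate_eq hx hN (hnN _ (by omega))]
  have hY := iterate_cfMap_mul_cfCross hx hy hxy' (J + i) (n (J + i))
  have hY' := iterate_cfMap_mul_cfCross hx hy hxy' (J + i') (n (J + i'))
  have hdvd : ∀ c : ℤ, |c| ≤ 4 * (D : ℤ) ^ 2 → c ≠ 0 → c ∣ (L : ℤ) := fun c hc hc0 =>
    Int.natAbs_dvd.1 (Int.natCast_dvd_natCast.2
      (Nat.dvd_factorial (Int.natAbs_pos.2 hc0) (by zify; exact hc)))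
  have hrow : (w (J + i + 1) (n (J + i) + 1) : ℝ) * cfMap^[n (J + i) + 1] x
      + w (J + i + 1) (n (J + i)) ≠ 0 := fun h0 => by
    have hirr := irrational_iterate_cfMap hx (n (J + i) + 1)
    have hd0 := cfCross_det D m x y (J + i) (n (J + i))
    have hc0 : w (J + i + 1) (n (J + i) + 1) = 0 := by
      by_contra hc0
      exact ((hirr.intCast_mul hc0).add_intCast _).ne_int 0 (by simpa using h0)
    have hc1 : w (J + i + 1) (n (J + i)) = 0 := by
      rw [hc0] at h0
      simpa using h0
    simp only [w] at hc0 hc1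
    rw [hc0, hc1, mul_zero, mul_zero, sub_zero, abs_zero] at hd0
    exact (pow_pos hDZ 2).ne hd0
  simp only [w] at hc hd hdt hrow ha hb
  rw [← hX, ← hc, ← hd] at hY'
  rw [← hc, ← hd] at hdt
  exact fract_eq_of_rows hrow hdt (hdvd _ (hn1 _)) (hdvd _ (hn2 _))
    ((ZMod.intCast_eq_intCast_iff_dvd_sub _ _ L).1 ha.symm)
    ((ZMod.intCast_eq_intCast_iff_dvd_sub _ _ L).1 hb.symm) hY hY'

theorem periodLength_of_not_irrational {x : ℝ} (hx : ¬Irrational x) : periodLength x = 0 :=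
  if_neg hx

theorem periodLength_of_irrational {x : ℝ} (hx : Irrational x) :
    periodLength x = sInf {p : ℕ | 0 < p ∧ CfPeriodic x p} :=
  if_pos hx

theorem exists_periodLength_translate_le (D : ℕ) (hD : 0 < D) :
    ∃ K : ℕ, ∀ (x y : ℝ) (m : ℤ), D * y = D * x + m → periodLength y ≤ K * periodLength x := by
  obtain ⟨K, hK⟩ := exists_cfPeriodic_translate D hD
  refine ⟨K, fun x y m hxy => ?_⟩
  have hD' : (D : ℝ) ≠ 0 := by exact_mod_cast hD.ne'
  by_cases hy : Irrational y
  swap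
  · simp [periodLength_of_not_irrational hy]
  have hx : Irrational x := fun ⟨r, hr⟩ => hy ⟨r + m / D, by
    push_cast
    rw [hr]
    field_simp
    linarith⟩
  rw [periodLength_of_irrational hx, periodLength_of_irrational hy]
  rcases Set.eq_empty_or_nonempty {p : ℕ | 0 < p ∧ CfPeriodic x p} with h | h
  · have hempty : {p : ℕ | 0 < p ∧ CfPeriodic y p} = ∅ := by
      refine Set.eq_empty_of_forall_notMem fun p hp => ?_
      obtain ⟨q, hq, -, hxq⟩ := hK y x (-m) p hy hx (by push_cast; linarith) hp.1 hp.2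
      exact Set.notMem_empty q (h ▸ ⟨hq, hxq⟩)
    simp [hempty]
  · obtain ⟨hp, hxp⟩ := Nat.sInf_mem h
    obtain ⟨q, hq, hle, hyq⟩ := hK x y m _ hx hy hxy hp hxp
    exact (Nat.sInf_le (show q ∈ {p : ℕ | 0 < p ∧ CfPeriodic y p} from ⟨hq, hyq⟩)).trans hle

/-- adding a sequence of rational numbers with bounded denominators to a
sequence in a real quadratic field does not affect boundedness of the period lengths. -/
theorem stmt_9 (K : IntermediateField ℚ ℝ) (hK : Module.finrank ℚ K = 2)
    (A : ℕ → K) (B : ℕ → ℚ)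
    (hB : ∃ D : ℕ, 0 < D ∧ ∀ n : ℕ, ∃ m : ℤ, (D : ℚ) * B n = (m : ℚ)) :
    (∃ C : ℕ, ∀ n : ℕ, periodLength (A n : ℝ) ≤ C) ↔
      (∃ C : ℕ, ∀ n : ℕ, periodLength ((A n : ℝ) + (B n : ℝ)) ≤ C) := by
  obtain ⟨D, hD, hm⟩ := hB
  choose m hm using hm
  obtain ⟨K', hK'⟩ := exists_periodLength_translate_le D hD
  have h : ∀ n, (D : ℝ) * B n = m n := fun n => by exact_mod_cast hm n
  constructor
  · rintro ⟨C, hC⟩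
    refine ⟨K' * C, fun n => (hK' (A n) _ (m n) ?_).trans (Nat.mul_le_mul_left _ (hC n))⟩
    rw [mul_add, h]
  · rintro ⟨C, hC⟩
    refine ⟨K' * C, fun n => (hK' _ (A n) (-m n) ?_).trans (Nat.mul_le_mul_left _ (hC n))⟩
    rw [mul_add, h]
    push_cast
    ring
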